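/- Let (𝔤, g, J_g) and (𝔥, h, J_h) be pseudo-Kähler Lie algebras and let φ : 𝔥 → Der(𝔤) define a pseudo-Kähler extension. Let 𝔨 be an ideal of 𝔥 contained in ker φ with J_h(𝔨) = 𝔨 and such that the restriction of h to 𝔨 is nondegenerate. Then: (a) (𝔨, h|_𝔨, J_h|_𝔨) is a pseudo-Kähler Lie algebra; (b) the projection π : 𝔥 → 𝔥/𝔨 restricts to a linear isomorphism 𝔨^⊥ → 𝔥/𝔨, and 𝔥/𝔨 equipped with the metric p and complex structure induced from h|_{𝔨^⊥} and J_h|_{𝔨^⊥} through this isomorphism is a pseudo-Kähler Lie algebra; (c) the induced homomorphism φ' : 𝔥/𝔨 → Der(𝔤) satisfies J_g∘φ'(a)^s = φ'(J a)^s and J_g∘φ'(a)^a = φ'(a)^a∘J_g for all a ∈ 𝔥/𝔨, so 𝔤 ⋊_{φ'} (𝔥/𝔨) is a pseudo-Kähler extension; (d) the inclusion 𝔨 → 𝔤 ⋊_φ 𝔥 and the map 𝔤 ⋊_φ 𝔥 → 𝔤 ⋊_{φ'} (𝔥/𝔨), X+A ↦ X+π(A), form a short exact sequence of Lie algebras 0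 → 𝔨 → 𝔤 ⋊_φ 𝔥 → 𝔤 ⋊_{φ'} (𝔥/𝔨) → 0. -/

import Mathlib

open Module

/-- A pseudo-Kähler Lie algebra structure. -/
def IsPseudoKahler (L : Type*) [LieRing L] [LieAlgebra ℝ L] [FiniteDimensional ℝ L]
    (g : L →ₗ[ℝ] L →ₗ[ℝ] ℝ) (J : Module.End ℝ L) : Prop :=
  (∀ x y, g x y = g y x) ∧
  (∀ x, (∀ y, g x y = 0) → x = 0) ∧
  (J ∘ₗ J = -1) ∧
  (∀ x y, g (J x) (J y) = g x y) ∧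
  ∀ lc : L →ₗ[ℝ] L →ₗ[ℝ] L,
    (∀ x y z, 2 * g (lc x y) z = g ⁅x, y⁆ z - g y ⁅x, z⁆ - g x ⁅y, z⁆) →
    ∀ x y, lc x (J y) = J (lc x y)

/-- A nondegenerate bilinear form on a finite-dimensional space identifies it with its dual. -/
theorem exists_linearEquiv_dual_of_nondegenerate {V : Type*} [AddCommGroup V] [Module ℝ V]
    [FiniteDimensional ℝ V] (B : V →ₗ[ℝ] V →ₗ[ℝ] ℝ)
    (hB : ∀ x, (∀ y, B x y = 0) → x = 0) :
    ∃ e : V ≃ₗ[ℝ] Dual ℝ V, ∀ x y, e x y = B x y := by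
  have hinj : Function.Injective B := by
    refine (injective_iff_map_eq_zero B).2 fun x hx => hB x fun y => ?_
    rw [hx, LinearMap.zero_apply]
  exact ⟨LinearEquiv.ofInjectiveOfFinrankEq B hinj Subspace.dual_finrank_eq.symm, fun x y => rfl⟩

/-- The right-hand side of the Koszul formula. -/
def koszul {L : Type*} [LieRing L] [LieAlgebra ℝ L] (g : L →ₗ[ℝ] L →ₗ[ℝ] ℝ) (x y z : L) : ℝ :=
  g ⁅x, y⁆ z - g y ⁅x, z⁆ - g x ⁅y, z⁆

/-- Existence of the Levi-Civita connection. -/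
theorem exists_leviCivita {L : Type*} [LieRing L] [LieAlgebra ℝ L] [FiniteDimensional ℝ L]
    (g : L →ₗ[ℝ] L →ₗ[ℝ] ℝ) (hg : ∀ x, (∀ y, g x y = 0) → x = 0) :
    ∃ lc : L →ₗ[ℝ] L →ₗ[ℝ] L, ∀ x y z, 2 * g (lc x y) z = koszul g x y z := by
  obtain ⟨e, he⟩ := exists_linearEquiv_dual_of_nondegenerate g hg
  let T : L → L → Dual ℝ L := fun x y =>
    (2⁻¹ : ℝ) • (g ⁅x, y⁆ - g y ∘ₗ (LieAlgebra.ad ℝ L x : Module.End ℝ L)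
      - g x ∘ₗ (LieAlgebra.ad ℝ L y : Module.End ℝ L))
  have hT : ∀ x y z, T x y z = 2⁻¹ * koszul g x y z := fun x y z => by
    simp [T, koszul]
  refine ⟨LinearMap.mk₂ ℝ (fun x y => e.symm (T x y)) ?_ ?_ ?_ ?_, fun x y z => ?_⟩
  · intro x x' y
    rw [← map_add]
    congr 1
    ext z
    simp only [hT, koszul, LinearMap.add_apply, add_lie, map_add]
    ring
  · intro c x y
    rw [← map_smul]
    congr 1
    ext z
    simp only [hT, koszul, LinearMap.smul_apply, smul_lie, map_smul, smul_eq_mul]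
    ring
  · intro x y y'
    rw [← map_add]
    congr 1
    ext z
    simp only [hT, koszul, LinearMap.add_apply, add_lie, lie_add, map_add]
    ring
  · intro c x y
    rw [← map_smul]
    congr 1
    ext z
    simp only [hT, koszul, LinearMap.smul_apply, smul_lie, lie_smul, map_smul, smul_eq_mul]
    ring
  · rw [← he, LinearMap.mk₂_apply, LinearEquiv.apply_symm_apply, hT]
    ring

/-- An isometric complex structure is skew-adjoint. -/
theorem skew_of_isometry {V : Type*} [AddCommGroup V] [Module ℝ V]
    {g : V →ₗ[ℝ] V →ₗ[ℝ] ℝ} {J : Module.End ℝ V} (hJ : J ∘ₗ J = -1)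
    (hgJ : ∀ x y, g (J x) (J y) = g x y) (x y : V) : g (J x) y = -g x (J y) := by
  have hJJ : J (J x) = -x := LinearMap.congr_fun hJ x
  rw [← hgJ (J x) y, hJJ, map_neg, LinearMap.neg_apply]

/-- `J` is parallel if and only if the Koszul form is skew under `J` in its last two arguments. -/
theorem isPseudoKahler_iff_koszul {L : Type*} [LieRing L] [LieAlgebra ℝ L]
    [FiniteDimensional ℝ L] (g : L →ₗ[ℝ] L →ₗ[ℝ] ℝ) (J : Module.End ℝ L) :
    IsPseudoKahler L g J ↔
      (∀ x y, g x y = g y x) ∧ (∀ x, (∀ y, g x y = 0) → x = 0) ∧ (J ∘ₗ J = -1) ∧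
      (∀ x y, g (J x) (J y) = g x y) ∧
      ∀ x y z, koszul g x (J y) z = -koszul g x y (J z) := by
  refine and_congr_right fun _ => and_congr_right fun hnd => and_congr_right fun hJ =>
    and_congr_right fun hgJ => ⟨fun hlc x y z => ?_, fun hk lc hlc x y => ?_⟩
  · obtain ⟨lc, h⟩ := exists_leviCivita g hnd
    rw [← h, ← h, hlc lc h, skew_of_isometry hJ hgJ]
    ring
  · refine sub_eq_zero.1 (hnd _ fun z => ?_)
    have h₁ : 2 * g (lc x (J y)) z = koszul g x (J y) z := hlc x (J y) z
    have h₂ : 2 * g (lc x y) (J z) = koszul g x y (J z) := hlc x y (J z)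
    rw [map_sub, LinearMap.sub_apply, skew_of_isometry hJ hgJ (lc x y)]
    linarith [hk x y z]

/-- Orthogonal decomposition along a nondegenerate subspace. -/
theorem exists_mem_sub_orthogonal {V : Type*} [AddCommGroup V] [Module ℝ V]
    [FiniteDimensional ℝ V] (B : V →ₗ[ℝ] V →ₗ[ℝ] ℝ) (W : Submodule ℝ V)
    (hW : ∀ b ∈ W, (∀ c ∈ W, B b c = 0) → b = 0) (a : V) :
    ∃ b ∈ W, ∀ c ∈ W, B (a - b) c = 0 := by
  obtain ⟨e, he⟩ := exists_linearEquiv_dual_of_nondegenerate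
    (B.compl₁₂ W.subtype W.subtype)
    fun x hx => Subtype.ext (hW x x.2 fun c hc => hx ⟨c, hc⟩)
  refine ⟨e.symm (B a ∘ₗ W.subtype), Subtype.prop _, fun c hc => ?_⟩
  have h := he (e.symm (B a ∘ₗ W.subtype)) ⟨c, hc⟩
  rw [LinearEquiv.apply_symm_apply] at h
  rw [map_sub, LinearMap.sub_apply, sub_eq_zero]
  exact h

/-- A `J`-invariant nondegenerate subalgebra of a pseudo-Kähler Lie algebra is pseudo-Kähler. -/
theorem IsPseudoKahler.restrict {L : Type*} [LieRing L] [LieAlgebra ℝ L]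
    [FiniteDimensional ℝ L] {h : L →ₗ[ℝ] L →ₗ[ℝ] ℝ} {J : Module.End ℝ L}
    (hpk : IsPseudoKahler L h J) (K : LieSubalgebra ℝ L) (hKJ : ∀ b ∈ K, J b ∈ K)
    (hKnd : ∀ b ∈ K, (∀ c ∈ K, h b c = 0) → b = 0) :
    IsPseudoKahler ↥K (h.compl₁₂ K.toSubmodule.subtype K.toSubmodule.subtype)
      (J.restrict (p := K.toSubmodule) (q := K.toSubmodule) hKJ) := by
  obtain ⟨hsymm, -, hJ, hgJ, hk⟩ := (isPseudoKahler_iff_koszul h J).1 hpk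
  exact (isPseudoKahler_iff_koszul _ _).2 ⟨fun x y => hsymm x y,
    fun x hx => Subtype.ext (hKnd x x.2 fun c hc => hx ⟨c, hc⟩),
    LinearMap.ext fun x => Subtype.ext (LinearMap.congr_fun hJ (x : L)),
    fun x y => hgJ x y, fun x y z => hk x y z⟩

section Quotient

variable {L q : Type*} [LieRing L] [LieAlgebra ℝ L]
  [LieRing q] [LieAlgebra ℝ q]
  (h : L →ₗ[ℝ] L →ₗ[ℝ] ℝ) (K : LieSubalgebra ℝ L) (π : L →ₗ⁅ℝ⁆ q)

/-- The projection restricts to a bijection from the orthogonal complement of its kernel. -/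
theorem bijective_restrict_orthogonal [FiniteDimensional ℝ L]
    (hKnd : ∀ b ∈ K, (∀ c ∈ K, h b c = 0) → b = 0)
    (hπsurj : Function.Surjective π) (hπker : ∀ b, π b = 0 ↔ b ∈ K) :
    Function.Bijective fun a : {a : L // ∀ c ∈ K, h a c = 0} => π a.1 := by
  constructor
  · rintro ⟨a, ha⟩ ⟨b, hb⟩ hab
    refine Subtype.ext (sub_eq_zero.1 (hKnd _ ?_ fun c hc => ?_))
    · rw [← hπker, map_sub, sub_eq_zero]
      exact hab
    · rw [map_sub, LinearMap.sub_apply, ha c hc, hb c hc, sub_zero]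
  · intro u
    obtain ⟨a, rfl⟩ := hπsurj u
    obtain ⟨b, hb, hab⟩ := exists_mem_sub_orthogonal h K.toSubmodule hKnd a
    refine ⟨⟨a - b, hab⟩, ?_⟩
    simp only [map_sub, (hπker b).2 hb, sub_zero]

/-- The inverse of the projection restricted to the orthogonal complement. -/
theorem exists_orthogonal_section (hbij : Function.Bijective
      fun a : {a : L // ∀ c ∈ K, h a c = 0} => π a.1) :
    ∃ s : q →ₗ[ℝ] L, (∀ u, π (s u) = u) ∧ (∀ u, ∀ c ∈ K, h (s u) c = 0) ∧
      ∀ a, (∀ c ∈ K, h a c = 0) → s (π a) = a := by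
  let W : Submodule ℝ L :=
    { carrier := {a | ∀ c ∈ K, h a c = 0}
      add_mem' := fun {a b} ha hb c hc => by
        rw [map_add, LinearMap.add_apply, ha c hc, hb c hc, add_zero]
      zero_mem' := fun c _ => by rw [map_zero, LinearMap.zero_apply]
      smul_mem' := fun r a ha c hc => by
        rw [map_smul, LinearMap.smul_apply, ha c hc, smul_zero] }
  let e : W ≃ₗ[ℝ] q := LinearEquiv.ofBijective ((π : L →ₗ[ℝ] q) ∘ₗ W.subtype) hbij
  exact ⟨W.subtype ∘ₗ e.symm.toLinearMap, fun u => e.apply_symm_apply u,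
    fun u => (e.symm u).2, fun a ha => congrArg Subtype.val (e.symm_apply_apply ⟨a, ha⟩)⟩

variable [FiniteDimensional ℝ L] [FiniteDimensional ℝ q] {h K π} {J : Module.End ℝ L}

/-- The structure induced on the quotient by a `J`-invariant ideal through a section onto
its orthogonal complement is pseudo-Kähler. -/
theorem IsPseudoKahler.quotient (hpk : IsPseudoKahler L h J) (hKJ : ∀ b ∈ K, J b ∈ K)
    (hπker : ∀ b, π b = 0 ↔ b ∈ K)
    {s : q →ₗ[ℝ] L} (hs : ∀ u, π (s u) = u) (hsK : ∀ u, ∀ c ∈ K, h (s u) c = 0)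
    (hsπ : ∀ a, (∀ c ∈ K, h a c = 0) → s (π a) = a) :
    IsPseudoKahler q (h.compl₁₂ s s) ((π : L →ₗ[ℝ] q) ∘ₗ J ∘ₗ s) := by
  obtain ⟨hsymm, hnd, hJ, hgJ, hk⟩ := (isPseudoKahler_iff_koszul h J).1 hpk
  have hmod : ∀ a, s (π a) - a ∈ K := fun a => by rw [← hπker, map_sub, hs, sub_self]
  have hright : ∀ u a, h (s u) (s (π a)) = h (s u) a := fun u a =>
    sub_eq_zero.1 (by rw [← map_sub]; exact hsK u _ (hmod a))
  have hleft : ∀ u a, h (s (π a)) (s u) = h a (s u) := fun u a => by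
    rw [hsymm, hright, hsymm]
  have hsJ : ∀ u, s (π (J (s u))) = J (s u) := fun u => hsπ _ fun c hc => by
    rw [skew_of_isometry hJ hgJ, hsK u _ (hKJ c hc), neg_zero]
  have hlie : ∀ u v, ⁅u, v⁆ = π ⁅s u, s v⁆ := fun u v => by rw [LieHom.map_lie, hs, hs]
  have hkos : ∀ u v w, koszul (h.compl₁₂ s s) u v w = koszul h (s u) (s v) (s w) :=
    fun u v w => by
      simp only [koszul, LinearMap.compl₁₂_apply, hlie, hleft, hright]
  refine (isPseudoKahler_iff_koszul _ _).2 ⟨fun u v => hsymm _ _, fun u hu => ?_,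
    LinearMap.ext fun u => ?_, fun u v => ?_, fun u v w => ?_⟩
  · have hsu : s u = 0 := hnd _ fun a => by
      rw [← hright]
      exact hu (π a)
    rw [← hs u, hsu, map_zero]
  · change π (J (s (π (J (s u))))) = -u
    have hJJ : J (J (s u)) = -s u := LinearMap.congr_fun hJ (s u)
    rw [hsJ, hJJ, map_neg, hs]
  · change h (s (π (J (s u)))) (s (π (J (s v)))) = h (s u) (s v)
    rw [hsJ, hsJ, hgJ]
  · rw [hkos, hkos]
    change koszul h (s u) (s (π (J (s v)))) (s w) = -koszul h (s u) (s v) (s (π (J (s w))))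
    rw [hsJ, hsJ, hk]

end Quotient

/-- The map between semidirect products induced by a homomorphism of the acting Lie algebras. -/
theorem exists_semidirect_lieHom {𝔤 𝔥 q G G' : Type*} [LieRing 𝔤] [LieAlgebra ℝ 𝔤]
    [LieRing 𝔥] [LieAlgebra ℝ 𝔥] [LieRing q] [LieAlgebra ℝ q]
    [LieRing G] [LieAlgebra ℝ G] [LieRing G'] [LieAlgebra ℝ G']
    {φ : 𝔥 →ₗ[ℝ] Module.End ℝ 𝔤} {φ' : q →ₗ[ℝ] Module.End ℝ 𝔤} {π : 𝔥 →ₗ⁅ℝ⁆ q}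
    (hφ : ∀ a, φ' (π a) = φ a)
    (i : 𝔤 →ₗ[ℝ] G) (p : 𝔥 →ₗ[ℝ] G)
    (hbij : Function.Bijective fun w : 𝔤 × 𝔥 => i w.1 + p w.2)
    (hbrk : ∀ x a y b, ⁅i x + p a, i y + p b⁆
      = i ⁅x, y⁆ + i (φ a y) - i (φ b x) + p ⁅a, b⁆)
    (i' : 𝔤 →ₗ[ℝ] G') (p' : q →ₗ[ℝ] G')
    (hbrk' : ∀ x y (u v : q), ⁅i' x + p' u, i' y + p' v⁆
      = i' ⁅x, y⁆ + i' (φ' u y) - i' (φ' v x) + p' ⁅u, v⁆) :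
    ∃ τ : G →ₗ⁅ℝ⁆ G', ∀ x a, τ (i x + p a) = i' x + p' (π a) := by
  let e : (𝔤 × 𝔥) ≃ₗ[ℝ] G := LinearEquiv.ofBijective (i.coprod p) hbij
  let t : G →ₗ[ℝ] G' := i'.coprod (p' ∘ₗ (π : 𝔥 →ₗ[ℝ] q)) ∘ₗ e.symm.toLinearMap
  have ht : ∀ x a, t (i x + p a) = i' x + p' (π a) := fun x a =>
    congrArg (i'.coprod (p' ∘ₗ (π : 𝔥 →ₗ[ℝ] q))) (e.symm_apply_apply (x, a))
  refine ⟨{ t with map_lie' := fun {v w} => ?_ }, ht⟩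
  obtain ⟨⟨x, a⟩, rfl⟩ := hbij.2 v
  obtain ⟨⟨y, b⟩, rfl⟩ := hbij.2 w
  change t ⁅i x + p a, i y + p b⁆ = ⁅t (i x + p a), t (i y + p b)⁆
  rw [hbrk, ht, ht, hbrk', hφ, hφ, ← map_add, ← map_sub, ht, LieHom.map_lie, map_sub, map_add]

/-- factoring out a nondegenerate `J_h`-invariant ideal `𝔨 ⊆ ker φ`
from a pseudo-Kähler extension (Proposition `factoroutkernel`). -/
theorem stmt_4
    (𝔤 𝔥 q G G' : Type*)
    [LieRing 𝔤] [LieAlgebra ℝ 𝔤] [FiniteDimensional ℝ 𝔤]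
    [LieRing 𝔥] [LieAlgebra ℝ 𝔥] [FiniteDimensional ℝ 𝔥]
    [LieRing q] [LieAlgebra ℝ q] [FiniteDimensional ℝ q]
    [LieRing G] [LieAlgebra ℝ G] [LieRing G'] [LieAlgebra ℝ G']
    (g : 𝔤 →ₗ[ℝ] 𝔤 →ₗ[ℝ] ℝ) (Jg : Module.End ℝ 𝔤)
    (h : 𝔥 →ₗ[ℝ] 𝔥 →ₗ[ℝ] ℝ) (Jh : Module.End ℝ 𝔥)
    (hpkg : IsPseudoKahler 𝔤 g Jg) (hpkh : IsPseudoKahler 𝔥 h Jh)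
    -- φ : 𝔥 → Der(𝔤), a Lie algebra homomorphism into the derivations of 𝔤
    (φ : 𝔥 →ₗ[ℝ] Module.End ℝ 𝔤)
    (hder : ∀ a x y, φ a ⁅x, y⁆ = ⁅φ a x, y⁆ + ⁅x, φ a y⁆)
    (hhom : ∀ a b, φ ⁅a, b⁆ = φ a ∘ₗ φ b - φ b ∘ₗ φ a)
    -- the g-adjoint on endomorphisms of 𝔤
    (adj : Module.End ℝ 𝔤 → Module.End ℝ 𝔤)
    (hadj : ∀ f x y, g (f x) y = g x (adj f y))
    -- φ defines a pseudo-Kähler extension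
    (hext : ∀ a : 𝔥,
        Jg ∘ₗ ((2⁻¹ : ℝ) • (φ a + adj (φ a))) = (2⁻¹ : ℝ) • (φ (Jh a) + adj (φ (Jh a)))
        ∧ Jg ∘ₗ ((2⁻¹ : ℝ) • (φ a - adj (φ a))) = ((2⁻¹ : ℝ) • (φ a - adj (φ a))) ∘ₗ Jg)
    -- 𝔨 : a J_h-invariant nondegenerate ideal contained in ker φ
    (K : LieSubalgebra ℝ 𝔥)
    (hKideal : ∀ (a : 𝔥), ∀ b ∈ K, ⁅a, b⁆ ∈ K)
    (hKker : ∀ b ∈ K, φ b = 0)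
    (hKJ : ∀ b ∈ K, Jh b ∈ K)
    (hKnd : ∀ b ∈ K, (∀ c ∈ K, h b c = 0) → b = 0)
    -- q is the quotient Lie algebra 𝔥/𝔨, presented through the projection π
    (π : 𝔥 →ₗ⁅ℝ⁆ q) (hπsurj : Function.Surjective π)
    (hπker : ∀ b, π b = 0 ↔ b ∈ K)
    -- G is the semidirect product 𝔤 ⋊_φ 𝔥, presented through i, p
    (i : 𝔤 →ₗ[ℝ] G) (p : 𝔥 →ₗ[ℝ] G)
    (hbij : Function.Bijective fun w : 𝔤 × 𝔥 => i w.1 + p w.2)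
    (hbrk : ∀ x a y b, ⁅i x + p a, i y + p b⁆
      = i ⁅x, y⁆ + i (φ a y) - i (φ b x) + p ⁅a, b⁆)
    -- G' is a semidirect product 𝔤 ⋊ q, presented through i', p'
    (i' : 𝔤 →ₗ[ℝ] G') (p' : q →ₗ[ℝ] G')
    (hbij' : Function.Bijective fun w : 𝔤 × q => i' w.1 + p' w.2) :
    -- (a) 𝔨 is a pseudo-Kähler Lie algebra
    IsPseudoKahler ↥K (h.compl₁₂ K.toSubmodule.subtype K.toSubmodule.subtype)
      (Jh.restrict (p := K.toSubmodule) (q := K.toSubmodule) hKJ)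
    -- (b) π restricts to a linear isomorphism 𝔨^⊥ → 𝔥/𝔨 ...
    ∧ (Function.Bijective fun a : {a : 𝔥 // ∀ c ∈ K, h a c = 0} => π a.1)
    ∧ ∃ (pq : q →ₗ[ℝ] q →ₗ[ℝ] ℝ) (Jq : Module.End ℝ q)
        (φ' : q →ₗ[ℝ] Module.End ℝ 𝔤),
        -- ... the structures induced from 𝔨^⊥ through this isomorphism ...
        (∀ a b : 𝔥, (∀ c ∈ K, h a c = 0) → (∀ c ∈ K, h b c = 0) →
          pq (π a) (π b) = h a b)
        ∧ (∀ a : 𝔥, (∀ c ∈ K, h a c = 0) → Jq (π a) = π (Jh a))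
        -- ... make 𝔥/𝔨 a pseudo-Kähler Lie algebra
        ∧ IsPseudoKahler q pq Jq
        -- (c) the induced map φ' satisfies the extension conditions
        ∧ (∀ a : 𝔥, φ' (π a) = φ a)
        ∧ (∀ u : q,
            Jg ∘ₗ ((2⁻¹ : ℝ) • (φ' u + adj (φ' u)))
              = (2⁻¹ : ℝ) • (φ' (Jq u) + adj (φ' (Jq u)))
            ∧ Jg ∘ₗ ((2⁻¹ : ℝ) • (φ' u - adj (φ' u)))
              = ((2⁻¹ : ℝ) • (φ' u - adj (φ' u))) ∘ₗ Jg)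
        -- (d) the short exact sequence 0 → 𝔨 → 𝔤 ⋊_φ 𝔥 → 𝔤 ⋊_φ' (𝔥/𝔨) → 0
        ∧ ((∀ x y (u v : q), ⁅i' x + p' u, i' y + p' v⁆
              = i' ⁅x, y⁆ + i' (φ' u y) - i' (φ' v x) + p' ⁅u, v⁆) →
            ∃ τ : G →ₗ⁅ℝ⁆ G',
              (∀ x a, τ (i x + p a) = i' x + p' (π a))
              ∧ Function.Surjective τ
              ∧ (∀ w, τ w = 0 ↔ ∃ b ∈ K, p b = w)
              ∧ Function.Injective fun b : ↥K => p (b : 𝔥)) := by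
  have hπbij := bijective_restrict_orthogonal h K π hKnd hπsurj hπker
  obtain ⟨s, hs, hsK, hsπ⟩ := exists_orthogonal_section h K π hπbij
  have hφ : ∀ a, φ (s (π a)) = φ a := fun a => by
    rw [← sub_eq_zero, ← map_sub]
    exact hKker _ ((hπker _).1 (by rw [map_sub, hs, sub_self]))
  refine ⟨hpkh.restrict K hKJ hKnd, hπbij, h.compl₁₂ s s, (π : 𝔥 →ₗ[ℝ] q) ∘ₗ Jh ∘ₗ s, φ ∘ₗ s,
    fun a b ha hb => ?_, fun a ha => ?_, hpkh.quotient hKJ hπker hs hsK hsπ, hφ,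
    fun u => ?_, fun hbrk' => ?_⟩
  · rw [LinearMap.compl₁₂_apply, hsπ a ha, hsπ b hb]
  · change π (Jh (s (π a))) = π (Jh a)
    rw [hsπ a ha]
  · change _ = (2⁻¹ : ℝ) • (φ (s (π (Jh (s u)))) + adj (φ (s (π (Jh (s u)))))) ∧ _
    rw [hφ]
    exact hext (s u)
  · obtain ⟨τ, hτ⟩ := exists_semidirect_lieHom (φ' := φ ∘ₗ s) hφ i p hbij hbrk i' p' hbrk'
    refine ⟨τ, hτ, fun w => ?_, fun w => ⟨fun hw => ?_, ?_⟩, fun b c hbc => ?_⟩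
    · obtain ⟨⟨x, u⟩, rfl⟩ := hbij'.2 w
      exact ⟨i x + p (s u), by rw [hτ, hs]⟩
    · obtain ⟨⟨x, a⟩, rfl⟩ := hbij.2 w
      have h0 : (x, π a) = ((0, 0) : 𝔤 × q) := hbij'.1 (by
        change i' x + p' (π a) = i' 0 + p' 0
        rw [← hτ, map_zero, map_zero, add_zero]
        exact hw)
      obtain ⟨rfl, ha⟩ := Prod.mk.inj h0
      exact ⟨a, (hπker a).1 ha, by simp only [map_zero, zero_add]⟩
    · rintro ⟨b, hb, rfl⟩
      have hb0 := hτ 0 b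
      rwa [(hπker b).2 hb, map_zero, map_zero, map_zero, zero_add, add_zero] at hb0
    · have h0 : ((0, (b : 𝔥)) : 𝔤 × 𝔥) = (0, (c : 𝔥)) :=
        hbij.1 (congrArg (i 0 + ·) hbc)
      exact Subtype.ext (Prod.mk.inj h0).2
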